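/- Let N ≥ 2, α ∈ (0,2) with α < N, R > 0, and let f be a measurable function on the ball B := B(0,R) ⊂ ℝ^N. Then ∫_B f^#(y) |G_B(0,y)| dy ≤ a·b·ω_N^{(N−α)/N} ∫_0^{|B|} s^{(α−N)/N} f*(s) ds, where a := 2^{−α}Γ(N/2)Γ(α/2)^{−2}π^{−N/2}R^{N−2} and b := ∫_0^∞ s^{α/2−1}(s+R²)^{−N/2} ds. -/

import Mathlib

open MeasureTheory Filter Set

noncomputable section

abbrev Euc (N : ℕ) := EuclideanSpace ℝ (Fin N)

/-- Decreasing rearrangement of `g` on `E`: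
`g*(s) = sup {t ≥ 0 : |{x ∈ E : |g x| > t}| > s}`. -/
def rearr {N : ℕ} (E : Set (Euc N)) (g : Euc N → ℝ) (s : ℝ) : ℝ :=
  sSup {t : ℝ | 0 ≤ t ∧ ENNReal.ofReal s < volume {x | x ∈ E ∧ t < |g x|}}

/-- Measure of the unit ball of `ℝ^N`. -/
def omegaN (N : ℕ) : ℝ := (volume (Metric.ball (0 : Euc N) 1)).toReal

/-- Schwarz rearrangement `f^#(x) = f*(ω_N |x|^N)`. -/
def schwarz {N : ℕ} (E : Set (Euc N)) (f : Euc N → ℝ) (x : Euc N) : ℝ :=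
  rearr E f (omegaN N * ‖x‖ ^ N)

/-- The Green function of the ball `B(0,R)` for the fractional Laplacian. -/
def greenBall (N : ℕ) (α R : ℝ) (x y : Euc N) : ℝ :=
  -((2 : ℝ) ^ (-α) * Real.Gamma (N / 2) / (Real.Gamma (α / 2)) ^ 2 /
      Real.pi ^ ((N : ℝ) / 2) / R ^ 2 * ‖x - y‖ ^ (α - N) *
    ∫ s in (0 : ℝ)..((R ^ 2 - ‖x‖ ^ 2) * (R ^ 2 - ‖y‖ ^ 2) / ‖x - y‖ ^ 2),
      s ^ (α / 2 - 1) * (s / R ^ 2 + 1) ^ (-(N : ℝ) / 2))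

/-- The constant `a = 2^{-α} Γ(N/2) Γ(α/2)^{-2} π^{-N/2} R^{N-2}`. -/
def aConst (N : ℕ) (α R : ℝ) : ℝ :=
  (2 : ℝ) ^ (-α) * Real.Gamma (N / 2) / (Real.Gamma (α / 2)) ^ 2 /
    Real.pi ^ ((N : ℝ) / 2) * R ^ ((N : ℝ) - 2)

/-- The constant `b = ∫_0^∞ s^{α/2-1} (s+R²)^{-N/2} ds`. -/
def bConst (N : ℕ) (α R : ℝ) : ℝ :=
  ∫ s in Ioi (0 : ℝ), s ^ (α / 2 - 1) * (s + R ^ 2) ^ (-(N : ℝ) / 2)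

theorem rearr_nonneg {N : ℕ} (E : Set (Euc N)) (g : Euc N → ℝ) (s : ℝ) : 0 ≤ rearr E g s :=
  Real.sSup_nonneg fun _ ht => ht.1

theorem schwarz_nonneg {N : ℕ} (E : Set (Euc N)) (g : Euc N → ℝ) (x : Euc N) :
    0 ≤ schwarz E g x :=
  rearr_nonneg _ _ _

theorem bddAbove_rearr_set {N : ℕ} {E : Set (Euc N)} (hE : MeasurableSet E)
    (hEfin : volume E ≠ ⊤) {g : Euc N → ℝ} (hg : Measurable g) {s : ℝ} (hs : 0 < s) :
    BddAbove {t : ℝ | 0 ≤ t ∧ ENNReal.ofReal s < volume {x | x ∈ E ∧ t < |g x|}} := by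
  have hanti : Antitone fun n : ℕ => {x | x ∈ E ∧ (n : ℝ) < |g x|} := by
    intro m n hmn x hx
    exact ⟨hx.1, lt_of_le_of_lt (by exact_mod_cast hmn) hx.2⟩
  have hmeas : ∀ n : ℕ, MeasurableSet {x | x ∈ E ∧ (n : ℝ) < |g x|} := fun n =>
    hE.inter (measurableSet_lt measurable_const hg.abs)
  have hlim := tendsto_measure_iInter_atTop (μ := (volume : Measure (Euc N)))
    (fun n => (hmeas n).nullMeasurableSet) hanti
    ⟨0, ne_top_of_le_ne_top hEfin (measure_mono fun x hx => hx.1)⟩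
  have hempty : (⋂ n : ℕ, {x | x ∈ E ∧ (n : ℝ) < |g x|}) = ∅ := by
    ext x
    simp only [mem_iInter, mem_ofPred_eq, mem_empty_iff_false, iff_false, not_forall]
    obtain ⟨n, hn⟩ := exists_nat_ge |g x|
    exact ⟨n, fun h => absurd h.2 (not_lt.2 hn)⟩
  rw [hempty, measure_empty] at hlim
  obtain ⟨n, hn⟩ := (hlim.eventually (gt_mem_nhds (ENNReal.ofReal_pos.2 hs))).exists
  refine ⟨n, fun t ht => ?_⟩
  by_contra! hlt
  refine absurd (ht.2.trans_le (measure_mono ?_)) (not_lt.2 hn.le)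
  exact fun x hx => ⟨hx.1, hlt.trans hx.2⟩

theorem rearr_antitoneOn {N : ℕ} {E : Set (Euc N)} (hE : MeasurableSet E)
    (hEfin : volume E ≠ ⊤) {g : Euc N → ℝ} (hg : Measurable g) :
    AntitoneOn (rearr E g) (Ioi 0) := by
  intro s hs t _ hst
  by_cases hne : {r : ℝ | 0 ≤ r ∧ ENNReal.ofReal t < volume {x | x ∈ E ∧ r < |g x|}}.Nonempty
  · exact csSup_le_csSup (bddAbove_rearr_set hE hEfin hg hs) hne
      fun r hr => ⟨hr.1, (ENNReal.ofReal_le_ofReal hst).trans_lt hr.2⟩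
  · rw [rearr, not_nonempty_iff_eq_empty.1 hne, Real.sSup_empty]
    exact rearr_nonneg E g s

theorem omegaN_pos (N : ℕ) : 0 < omegaN N :=
  ENNReal.toReal_pos (Metric.measure_ball_pos _ _ one_pos).ne' measure_ball_lt_top.ne

theorem volume_closedBall_zero_eq_ofReal {N : ℕ} {r : ℝ} (hr : 0 ≤ r) :
    volume (Metric.closedBall (0 : Euc N) r) = ENNReal.ofReal (omegaN N * r ^ N) := by
  rw [Measure.addHaar_closedBall _ _ hr, finrank_euclideanSpace_fin, mul_comm,
    ENNReal.ofReal_mul (omegaN_pos N).le, omegaN, ENNReal.ofReal_toReal measure_ball_lt_top.ne]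

theorem volume_ball_zero_eq_ofReal {N : ℕ} {r : ℝ} (hr : 0 < r) :
    volume (Metric.ball (0 : Euc N) r) = ENNReal.ofReal (omegaN N * r ^ N) := by
  rw [Measure.addHaar_ball_of_pos _ _ hr, finrank_euclideanSpace_fin, mul_comm,
    ENNReal.ofReal_mul (omegaN_pos N).le, omegaN, ENNReal.ofReal_toReal measure_ball_lt_top.ne]

/-- The map `y ↦ ω_N |y|^N` carries Lebesgue measure on a ball to Lebesgue measure on an
interval. -/
theorem measurePreserving_omegaN_mul_norm_pow {N : ℕ} (hN : N ≠ 0) {R : ℝ} (hR : 0 < R) :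
    MeasurePreserving (fun y : Euc N => omegaN N * ‖y‖ ^ N)
      (volume.restrict (Metric.ball 0 R)) (volume.restrict (Ioc 0 (omegaN N * R ^ N))) := by
  have hω := omegaN_pos N
  have hmeas : Measurable fun y : Euc N => omegaN N * ‖y‖ ^ N := by fun_prop
  refine ⟨hmeas, ?_⟩
  have : IsFiniteMeasure (volume.restrict (Metric.ball (0 : Euc N) R)) :=
    ⟨by rw [Measure.restrict_apply_univ]; exact measure_ball_lt_top⟩
  refine Measure.ext_of_Iic _ _ fun t => ?_
  rw [Measure.map_apply hmeas measurableSet_Iic,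
    Measure.restrict_apply (hmeas measurableSet_Iic), Measure.restrict_apply measurableSet_Iic]
  rcases lt_or_ge t 0 with ht | ht
  · have h1 : (fun y : Euc N => omegaN N * ‖y‖ ^ N) ⁻¹' Iic t ∩ Metric.ball 0 R = ∅ := by
      ext y
      simp only [mem_inter_iff, mem_preimage, mem_Iic, mem_empty_iff_false, iff_false, not_and]
      intro h
      have : 0 ≤ omegaN N * ‖y‖ ^ N := by positivity
      linarith
    have h2 : Iic t ∩ Ioc 0 (omegaN N * R ^ N) = ∅ := by
      ext y
      simp only [mem_inter_iff, mem_Iic, mem_Ioc, mem_empty_iff_false, iff_false]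
      intro h
      linarith [h.1, h.2.1]
    rw [h1, h2, measure_empty, measure_empty]
  rcases lt_or_ge t (omegaN N * R ^ N) with htR | htR
  · set r : ℝ := (t / omegaN N) ^ ((N : ℝ)⁻¹) with hr
    have hr0 : 0 ≤ r := by positivity
    have hrN : omegaN N * r ^ N = t := by
      rw [hr, Real.rpow_inv_natCast_pow (by positivity) hN]
      field_simp
    have hrR : r < R := by
      rw [← hrN] at htR
      exact lt_of_pow_lt_pow_left₀ N hR.le (lt_of_mul_lt_mul_left htR hω.le)
    have h1 : (fun y : Euc N => omegaN N * ‖y‖ ^ N) ⁻¹' Iic t ∩ Metric.ball 0 R =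
        Metric.closedBall 0 r := by
      ext y
      simp only [mem_inter_iff, mem_preimage, mem_Iic, mem_ball_zero_iff, mem_closedBall_zero_iff]
      rw [← hrN, mul_le_mul_iff_right₀ hω, pow_le_pow_iff_left₀ (norm_nonneg y) hr0 hN]
      exact ⟨fun h => h.1, fun h => ⟨h, h.trans_lt hrR⟩⟩
    have h2 : Iic t ∩ Ioc 0 (omegaN N * R ^ N) = Ioc 0 t := by
      ext y
      simp only [mem_inter_iff, mem_Iic, mem_Ioc]
      exact ⟨fun h => ⟨h.2.1, h.1⟩, fun h => ⟨h.2, h.1, h.2.trans htR.le⟩⟩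
    rw [h1, h2, volume_closedBall_zero_eq_ofReal hr0, hrN, Real.volume_Ioc, sub_zero]
  · have h1 : (fun y : Euc N => omegaN N * ‖y‖ ^ N) ⁻¹' Iic t ∩ Metric.ball 0 R =
        Metric.ball 0 R := by
      refine inter_eq_right.2 fun y hy => ?_
      rw [mem_ball_zero_iff] at hy
      exact (mul_le_mul_of_nonneg_left (pow_le_pow_left₀ (norm_nonneg y) hy.le N) hω.le).trans htR
    rw [h1, inter_eq_right.2 fun y hy => hy.2.trans htR, volume_ball_zero_eq_ofReal hR,
      Real.volume_Ioc, sub_zero]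

theorem integrableOn_bConst_integrand {N : ℕ} {α R : ℝ} (hα : 0 < α) (hαN : α < N) (hR : 0 < R) :
    IntegrableOn (fun s : ℝ => s ^ (α / 2 - 1) * (s + R ^ 2) ^ (-(N : ℝ) / 2)) (Ioi 0) := by
  have hmeas : Measurable fun s : ℝ => s ^ (α / 2 - 1) * (s + R ^ 2) ^ (-(N : ℝ) / 2) := by
    fun_prop
  have hneg : -(N : ℝ) / 2 ≤ 0 := by linarith
  rw [← Ioc_union_Ioi_eq_Ioi zero_le_one]
  refine IntegrableOn.union ?_ ?_
  · have h : IntegrableOn (fun s : ℝ => s ^ (α / 2 - 1) * (R ^ 2) ^ (-(N : ℝ) / 2)) (Ioc 0 1) :=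
      ((intervalIntegrable_iff_integrableOn_Ioc_of_le zero_le_one).1
        (intervalIntegral.intervalIntegrable_rpow' (by linarith))).mul_const _
    refine h.mono' hmeas.aestronglyMeasurable ?_
    filter_upwards [ae_restrict_mem measurableSet_Ioc] with s hs
    have hs0 := hs.1
    rw [Real.norm_of_nonneg (by positivity)]
    gcongr ?_ * ?_
    exact Real.rpow_le_rpow_of_nonpos (by positivity) (by linarith) hneg
  · have h : IntegrableOn (fun s : ℝ => s ^ (α / 2 - 1 + -(N : ℝ) / 2)) (Ioi 1) :=
      integrableOn_Ioi_rpow_of_lt (by linarith) one_pos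
    refine h.mono' hmeas.aestronglyMeasurable ?_
    filter_upwards [ae_restrict_mem measurableSet_Ioi] with s hs
    have hs0 : (0 : ℝ) < s := one_pos.trans hs
    rw [Real.norm_of_nonneg (by positivity), Real.rpow_add hs0]
    gcongr ?_ * ?_
    exact Real.rpow_le_rpow_of_nonpos hs0 (by linarith [sq_nonneg R]) hneg

theorem aConst_pos {N : ℕ} (hN : N ≠ 0) {α R : ℝ} (hα : 0 < α) (hR : 0 < R) :
    0 < aConst N α R := by
  have h1 : 0 < Real.Gamma ((N : ℝ) / 2) := Real.Gamma_pos_of_pos (by positivity)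
  have h2 : 0 < Real.Gamma (α / 2) := Real.Gamma_pos_of_pos (by positivity)
  unfold aConst
  positivity

theorem abs_greenBall_zero {N : ℕ} (hN : N ≠ 0) {α R : ℝ} (hα : 0 < α) (hR : 0 < R)
    {y : Euc N} (hy : ‖y‖ < R) :
    |greenBall N α R 0 y| = aConst N α R * ‖y‖ ^ (α - N) *
      ∫ s in Ioc 0 (R ^ 2 * (R ^ 2 - ‖y‖ ^ 2) / ‖y‖ ^ 2),
        s ^ (α / 2 - 1) * (s + R ^ 2) ^ (-(N : ℝ) / 2) := by
  have hz : 0 ≤ R ^ 2 * (R ^ 2 - ‖y‖ ^ 2) / ‖y‖ ^ 2 := by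
    have : ‖y‖ ^ 2 ≤ R ^ 2 := by gcongr
    have := sub_nonneg.2 this
    positivity
  have hint : (∫ s in Ioc 0 (R ^ 2 * (R ^ 2 - ‖y‖ ^ 2) / ‖y‖ ^ 2),
        s ^ (α / 2 - 1) * (s / R ^ 2 + 1) ^ (-(N : ℝ) / 2)) = R ^ (N : ℝ) *
      ∫ s in Ioc 0 (R ^ 2 * (R ^ 2 - ‖y‖ ^ 2) / ‖y‖ ^ 2),
        s ^ (α / 2 - 1) * (s + R ^ 2) ^ (-(N : ℝ) / 2) := by
    rw [← integral_const_mul]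
    refine setIntegral_congr_fun measurableSet_Ioc fun s hs => ?_
    have hs0 := hs.1
    have h1 : s / R ^ 2 + 1 = (s + R ^ 2) / R ^ 2 := by field_simp
    have h2 : (R ^ 2) ^ (-(N : ℝ) / 2) = (R ^ (N : ℝ))⁻¹ := by
      rw [← Real.rpow_natCast, ← Real.rpow_mul hR.le, ← Real.rpow_neg hR.le]
      congr 1
      push_cast
      ring
    rw [h1, Real.div_rpow (by positivity) (by positivity), h2]
    field_simp
  have hRN : R ^ ((N : ℝ) - 2) = R ^ (N : ℝ) / R ^ 2 := by
    rw [Real.rpow_sub hR, Real.rpow_two]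
  have hJ : 0 ≤ ∫ s in Ioc 0 (R ^ 2 * (R ^ 2 - ‖y‖ ^ 2) / ‖y‖ ^ 2),
        s ^ (α / 2 - 1) * (s + R ^ 2) ^ (-(N : ℝ) / 2) :=
    setIntegral_nonneg measurableSet_Ioc fun s hs => by
      have hs0 := hs.1
      positivity
  have ha := aConst_pos hN hα hR
  have hG : greenBall N α R 0 y = -(aConst N α R * ‖y‖ ^ (α - N) *
      ∫ s in Ioc 0 (R ^ 2 * (R ^ 2 - ‖y‖ ^ 2) / ‖y‖ ^ 2),
        s ^ (α / 2 - 1) * (s + R ^ 2) ^ (-(N : ℝ) / 2)) := by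
    rw [greenBall, aConst, hRN]
    simp only [zero_sub, norm_neg, norm_zero, ne_eq, OfNat.ofNat_ne_zero, not_false_eq_true,
      zero_pow, sub_zero]
    rw [intervalIntegral.integral_of_le hz, hint]
    ring
  rw [hG, abs_neg, abs_of_nonneg (by positivity)]

/-- Upper bound `|G_B(0,y)| ≤ a b |y|^{α-N}`. -/
theorem abs_greenBall_zero_le {N : ℕ} (hN : N ≠ 0) {α R : ℝ} (hα : 0 < α) (hαN : α < N)
    (hR : 0 < R) {y : Euc N} (hy : ‖y‖ < R) :
    |greenBall N α R 0 y| ≤ aConst N α R * bConst N α R * ‖y‖ ^ (α - N) := by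
  have ha := aConst_pos hN hα hR
  rw [abs_greenBall_zero hN hα hR hy, mul_right_comm]
  gcongr
  refine setIntegral_mono_set (integrableOn_bConst_integrand hα hαN hR) ?_
    (Eventually.of_forall fun s hs => hs.1)
  filter_upwards [ae_restrict_mem measurableSet_Ioi] with s hs
  have hs0 : (0 : ℝ) < s := hs
  simp only [Pi.zero_apply]
  positivity

/-- Away from the boundary, `|G_B(0,y)|` is at least a constant times `|y|^{α-N}`. -/
theorem exists_le_abs_greenBall_zero {N : ℕ} (hN : N ≠ 0) {α R : ℝ} (hα : 0 < α) (hαN : α < N)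
    (hR : 0 < R) :
    ∃ c : ℝ, 0 < c ∧ ∀ y : Euc N, y ≠ 0 → ‖y‖ < R / 2 →
      ‖y‖ ^ (α - N) ≤ c * |greenBall N α R 0 y| := by
  have ha := aConst_pos hN hα hR
  have hint := integrableOn_bConst_integrand (N := N) hα hαN hR
  set J : ℝ := ∫ s in Ioc 0 (R ^ 2), s ^ (α / 2 - 1) * (s + R ^ 2) ^ (-(N : ℝ) / 2) with hJdef
  have hpos : ∀ s ∈ Ioi (0 : ℝ), 0 < s ^ (α / 2 - 1) * (s + R ^ 2) ^ (-(N : ℝ) / 2) := by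
    intro s hs
    have hs0 : (0 : ℝ) < s := hs
    positivity
  have hJ : 0 < J := by
    have hR2 : 0 < R ^ 2 := by positivity
    rw [hJdef, ← intervalIntegral.integral_of_le hR2.le]
    exact intervalIntegral.intervalIntegral_pos_of_pos_on
      ((intervalIntegrable_iff_integrableOn_Ioc_of_le hR2.le).2
        (hint.mono_set Ioc_subset_Ioi_self)) (fun s hs => hpos s hs.1) hR2
  refine ⟨(aConst N α R * J)⁻¹, by positivity, fun y hy0 hy => ?_⟩
  have hy0' : 0 < ‖y‖ := norm_pos_iff.2 hy0
  rw [abs_greenBall_zero hN hα hR (by linarith), inv_mul_eq_div, le_div_iff₀ (by positivity)]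
  have hle : J ≤ ∫ s in Ioc 0 (R ^ 2 * (R ^ 2 - ‖y‖ ^ 2) / ‖y‖ ^ 2),
        s ^ (α / 2 - 1) * (s + R ^ 2) ^ (-(N : ℝ) / 2) := by
    refine setIntegral_mono_set (hint.mono_set Ioc_subset_Ioi_self) ?_
      (Eventually.of_forall fun s hs => ⟨hs.1, hs.2.trans ?_⟩)
    · filter_upwards [ae_restrict_mem measurableSet_Ioc] with s hs
      exact (hpos s hs.1).le
    · rw [le_div_iff₀ (by positivity)]
      gcongr
      nlinarith
  calc ‖y‖ ^ (α - N) * (aConst N α R * J) = aConst N α R * ‖y‖ ^ (α - N) * J := by ring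
    _ ≤ _ := by gcongr

/-- `∫_B f^#(y) |G_B(0,y)| dy ≤ a b ω_N^{(N-α)/N} ∫_0^{|B|} s^{(α-N)/N} f*(s) ds`. -/
theorem green_schwarz_estimate
    {N : ℕ} (hN : 2 ≤ N) (α : ℝ) (hα : α ∈ Ioo (0 : ℝ) 2) (hαN : α < N)
    (R : ℝ) (hR : 0 < R) (f : Euc N → ℝ) (hf : Measurable f) :
    (∫ y in Metric.ball (0 : Euc N) R,
        schwarz (Metric.ball (0 : Euc N) R) f y * |greenBall N α R 0 y|) ≤
      aConst N α R * bConst N α R * omegaN N ^ (((N : ℝ) - α) / N) *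
        ∫ s in (0 : ℝ)..(volume (Metric.ball (0 : Euc N) R)).toReal,
          s ^ ((α - N) / (N : ℝ)) * rearr (Metric.ball (0 : Euc N) R) f s := by
  have hN0 : N ≠ 0 := by omega
  have hω := omegaN_pos N
  have ha := aConst_pos hN0 hα.1 hR
  have hb : 0 ≤ bConst N α R := setIntegral_nonneg measurableSet_Ioi fun s hs => by
    have hs0 : (0 : ℝ) < s := hs
    positivity
  have hanti : AntitoneOn (rearr (Metric.ball (0 : Euc N) R) f) (Ioi 0) :=
    rearr_antitoneOn measurableSet_ball measure_ball_lt_top.ne hf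
  set B : Set (Euc N) := Metric.ball 0 R with hB
  set Φ : Euc N → ℝ := fun y => omegaN N * ‖y‖ ^ N with hΦ
  set F : ℝ → ℝ := fun s => s ^ ((α - N) / (N : ℝ)) * rearr B f s with hF
  set W : ℝ := omegaN N ^ (((N : ℝ) - α) / N) with hW
  have hV : (volume B).toReal = omegaN N * R ^ N := by
    rw [hB, volume_ball_zero_eq_ofReal hR, ENNReal.toReal_ofReal (by positivity)]
  have hmp := measurePreserving_omegaN_mul_norm_pow hN0 hR
  have hFmeas : AEStronglyMeasurable F (volume.restrict (Ioc 0 (omegaN N * R ^ N))) :=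
    ((by fun_prop : Measurable fun s : ℝ => s ^ ((α - N) / (N : ℝ))).aemeasurable.mul
      (aemeasurable_restrict_of_antitoneOn measurableSet_Ioc
        (hanti.mono Ioc_subset_Ioi_self))).aestronglyMeasurable
  have hkernel : ∀ y : Euc N, y ≠ 0 →
      W * F (Φ y) = schwarz B f y * ‖y‖ ^ (α - N) := by
    intro y hy
    have hy0 : 0 < ‖y‖ := norm_pos_iff.2 hy
    have hN' : (N : ℝ) ≠ 0 := by exact_mod_cast hN0
    have h1 : (Φ y) ^ ((α - N) / (N : ℝ)) = W⁻¹ * ‖y‖ ^ (α - N) := by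
      rw [hΦ, hW, Real.mul_rpow hω.le (by positivity), ← Real.rpow_neg hω.le,
        ← Real.rpow_natCast, ← Real.rpow_mul hy0.le, mul_div_cancel₀ _ hN']
      congr 2
      ring
    have hW0 : W ≠ 0 := by positivity
    simp only [hF]
    rw [h1, schwarz]
    field_simp
    rfl
  have hne : ∀ᵐ y ∂(volume.restrict B), y ≠ (0 : Euc N) := by
    have : Nonempty (Fin N) := ⟨⟨0, by omega⟩⟩
    exact ae_restrict_of_ae (by simp [ae_iff])
  have hint : (∫ y in B, F (Φ y)) = ∫ s in (0 : ℝ)..(volume B).toReal, F s := by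
    rw [hV, intervalIntegral.integral_of_le (by positivity), ← hmp.map_eq,
      integral_map hmp.measurable.aemeasurable (by rwa [hmp.map_eq])]
  have hrhs : 0 ≤ aConst N α R * bConst N α R * W * ∫ y in B, F (Φ y) := by
    have : 0 ≤ ∫ y in B, F (Φ y) := integral_nonneg fun y =>
      mul_nonneg (by positivity) (rearr_nonneg _ _ _)
    positivity
  rw [← hint]
  by_cases hG : IntegrableOn (fun y => schwarz B f y * |greenBall N α R 0 y|) B
  swap
  · rw [integral_undef hG]
    exact hrhs
  have hFint : IntegrableOn (fun y => W * F (Φ y)) B := by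
    obtain ⟨c, hc, hcG⟩ := exists_le_abs_greenBall_zero hN0 hα.1 hαN hR
    have hconst : IntegrableOn (fun _ : Euc N =>
        rearr B f (omegaN N * (R / 2) ^ N) * (R / 2) ^ (α - N)) B :=
      integrableOn_const measure_ball_lt_top.ne
    refine ((hG.const_mul c).add hconst).mono'
      ((hFmeas.comp_measurePreserving hmp).const_mul W) ?_
    filter_upwards [hne] with y hy
    have hs := schwarz_nonneg B f y
    have hy0 : 0 < ‖y‖ := norm_pos_iff.2 hy
    have hr := rearr_nonneg B f (omegaN N * (R / 2) ^ N)
    rw [hkernel y hy, Real.norm_of_nonneg (by positivity)]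
    simp only [Pi.add_apply]
    rcases lt_or_ge ‖y‖ (R / 2) with hlt | hge
    · have h1 := mul_le_mul_of_nonneg_left (hcG y hy hlt) hs
      have h2 : 0 ≤ rearr B f (omegaN N * (R / 2) ^ N) * (R / 2) ^ (α - N) := by positivity
      linarith
    · have h1 : schwarz B f y ≤ rearr B f (omegaN N * (R / 2) ^ N) :=
        hanti (mem_Ioi.2 (by positivity)) (mem_Ioi.2 (by positivity)) (by gcongr)
      have h2 : ‖y‖ ^ (α - N) ≤ (R / 2) ^ (α - N) :=
        Real.rpow_le_rpow_of_nonpos (by positivity) hge (by linarith)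
      have h3 := mul_le_mul h1 h2 (by positivity) hr
      have h4 : 0 ≤ c * (schwarz B f y * |greenBall N α R 0 y|) := by positivity
      linarith
  calc (∫ y in B, schwarz B f y * |greenBall N α R 0 y|)
      ≤ ∫ y in B, aConst N α R * bConst N α R * (W * F (Φ y)) := by
        refine integral_mono_of_nonneg
          (Eventually.of_forall fun y => mul_nonneg (schwarz_nonneg _ _ _) (abs_nonneg _))
          (hFint.const_mul _) ?_
        filter_upwards [hne, ae_restrict_mem measurableSet_ball] with y hy hyB
        rw [hkernel y hy]
        have h1 := mul_le_mul_of_nonneg_left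
          (abs_greenBall_zero_le hN0 hα.1 hαN hR (mem_ball_zero_iff.1 hyB))
          (schwarz_nonneg B f y)
        linarith
    _ = aConst N α R * bConst N α R * W * ∫ y in B, F (Φ y) := by
        rw [integral_const_mul, integral_const_mul]
        ring
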